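/- The ring R (the Segre product of three polynomial rings over K in m, n, p variables) is an integral domain which is integrally closed in its field of fractions. -/

import Mathlib

open MvPolynomial

/-- Sum of the `X`-exponents of a monomial exponent vector. -/
def asum (m n p : ℕ) (σ : (Fin m ⊕ Fin n ⊕ Fin p) →₀ ℕ) : ℤ :=
  ∑ a : Fin m, (σ (Sum.inl a) : ℤ)

/-- Sum of the `Y`-exponents of a monomial exponent vector. -/
def bsum (m n p : ℕ) (σ : (Fin m ⊕ Fin n ⊕ Fin p) →₀ ℕ) : ℤ :=
  ∑ b : Fin n, (σ (Sum.inr (Sum.inl b)) : ℤ)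

/-- Sum of the `Z`-exponents of a monomial exponent vector. -/
def csum (m n p : ℕ) (σ : (Fin m ⊕ Fin n ⊕ Fin p) →₀ ℕ) : ℤ :=
  ∑ c : Fin p, (σ (Sum.inr (Sum.inr c)) : ℤ)

/-- The Segre product `R` of three polynomial rings: the `K`-subalgebra of
`P = K[X₁,…,X_m,Y₁,…,Y_n,Z₁,…,Z_p]` spanned by all monomials with `|α| = |β| = |γ|`. -/
noncomputable def segreRing (K : Type*) [Field K] (m n p : ℕ) :
    Subalgebra K (MvPolynomial (Fin m ⊕ Fin n ⊕ Fin p) K) :=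
  Algebra.adjoin K
    {f | ∃ σ, asum m n p σ = bsum m n p σ ∧ asum m n p σ = csum m n p σ ∧
      f = monomial σ (1 : K)}

/-- The class module `M_{(i,j)}`: the subspace of `P` spanned by all monomials with
`|α| = |β| + i` and `|α| = |γ| + j`, as a module over the Segre product `R`. -/
noncomputable def segreClassModule (K : Type*) [Field K] (m n p : ℕ) (i j : ℤ) :
    Submodule (segreRing K m n p) (MvPolynomial (Fin m ⊕ Fin n ⊕ Fin p) K) :=
  Submodule.span (segreRing K m n p)
    {f | ∃ σ, asum m n p σ = bsum m n p σ + i ∧ asum m n p σ = csum m n p σ + j ∧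
      f = monomial σ (1 : K)}

/-- A subring `A` of an integrally closed domain `B` is integrally closed as soon as every element
of `B` that is a quotient of elements of `A` lies in `A`. -/
theorem IsIntegrallyClosed.of_injective_of_forall_mul_mem_range {A B : Type*} [CommRing A]
    [IsDomain A] [CommRing B] [IsDomain B] [IsIntegrallyClosed B] (f : A →+* B)
    (hf : Function.Injective f)
    (h : ∀ (s : A) (b : B), s ≠ 0 → f s * b ∈ f.range → b ∈ f.range) :
    IsIntegrallyClosed A := by
  rw [isIntegrallyClosed_iff (FractionRing A)]
  intro x hx
  let φ : FractionRing A →+* FractionRing B := IsFractionRing.map (j := f) hf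
  have hφ (a : A) : φ (algebraMap A _ a) = algebraMap B _ (f a) := IsLocalization.map_eq _ a
  have hint : IsIntegral B (φ x) := by
    obtain ⟨q, hq, hqx⟩ := hx
    refine ⟨q.map f, hq.map f, ?_⟩
    rw [Polynomial.eval₂_map,
      show (algebraMap B (FractionRing B)).comp f = φ.comp (algebraMap A _) from
        RingHom.ext fun a => (hφ a).symm,
      ← Polynomial.hom_eval₂, hqx, map_zero]
  obtain ⟨b, hb⟩ := IsIntegrallyClosed.isIntegral_iff.mp hint
  obtain ⟨r, s, hs, rfl⟩ := IsFractionRing.div_surjective (A := A) x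
  have hs0 : s ≠ 0 := nonZeroDivisors.ne_zero hs
  have hsK : algebraMap A (FractionRing A) s ≠ 0 := by simpa using hs0
  have hsL : algebraMap B (FractionRing B) (f s) ≠ 0 := by
    simpa using (map_ne_zero_iff f hf).mpr hs0
  have hsb : f s * b = f r := by
    apply IsFractionRing.injective B (FractionRing B)
    rw [map_mul, hb, map_div₀, hφ, hφ, mul_div_cancel₀ _ hsL]
  obtain ⟨a, rfl⟩ := h s b hs0 ⟨r, hsb.symm⟩
  refine ⟨a, ?_⟩
  rw [eq_div_iff hsK, ← map_mul, mul_comm a s]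
  rw [← map_mul] at hsb
  rw [hf hsb]

/-- In a graded domain, a quotient of degree-zero elements has degree zero. -/
theorem GradedRing.mem_zero_of_mul_mem_zero {ι A σ : Type*} [AddMonoid ι] [DecidableEq ι]
    [CommRing A] [IsDomain A] [SetLike σ A] [AddSubmonoidClass σ A] (𝒜 : ι → σ) [GradedRing 𝒜]
    {a b : A} (ha : a ∈ 𝒜 0) (ha0 : a ≠ 0) (hab : a * b ∈ 𝒜 0) : b ∈ 𝒜 0 := by
  have h := DirectSum.coe_decompose_mul_of_left_mem_zero 𝒜 (j := 0) (b := b) ha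
  rw [DirectSum.decompose_of_mem_same 𝒜 hab] at h
  rw [mul_left_cancel₀ ha0 h]
  exact SetLike.coe_mem _

/-- The weights whose degree-zero part is the Segre product. -/
def segreWeight (m n p : ℕ) : Fin m ⊕ Fin n ⊕ Fin p → ℤ × ℤ :=
  Sum.elim (fun _ => (1, 1)) (Sum.elim (fun _ => (-1, 0)) fun _ => (0, -1))

theorem weight_segreWeight (m n p : ℕ) (σ : (Fin m ⊕ Fin n ⊕ Fin p) →₀ ℕ) :
    Finsupp.weight (segreWeight m n p) σ =
      (asum m n p σ - bsum m n p σ, asum m n p σ - csum m n p σ) := by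
  rw [Finsupp.weight_apply, Finsupp.sum_fintype _ _ (by simp)]
  simp [Fintype.sum_sum_type, segreWeight, asum, bsum, csum, Prod.ext_iff, Prod.fst_sum,
    Prod.snd_sum, sub_eq_add_neg]

theorem weight_segreWeight_eq_zero_iff (m n p : ℕ) (σ : (Fin m ⊕ Fin n ⊕ Fin p) →₀ ℕ) :
    Finsupp.weight (segreWeight m n p) σ = 0 ↔
      asum m n p σ = bsum m n p σ ∧ asum m n p σ = csum m n p σ := by
  simp [weight_segreWeight, Prod.ext_iff, sub_eq_zero]

theorem mem_segreRing_iff (K : Type*) [Field K] (m n p : ℕ)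
    (f : MvPolynomial (Fin m ⊕ Fin n ⊕ Fin p) K) :
    f ∈ segreRing K m n p ↔ f ∈ weightedHomogeneousSubmodule K (segreWeight m n p) 0 := by
  rw [mem_weightedHomogeneousSubmodule]
  constructor
  · intro hf
    induction hf using Algebra.adjoin_induction with
    | mem x hx =>
      obtain ⟨σ, hab, hac, rfl⟩ := hx
      exact isWeightedHomogeneous_monomial _ _ _
        ((weight_segreWeight_eq_zero_iff m n p σ).mpr ⟨hab, hac⟩)
    | algebraMap r => exact isWeightedHomogeneous_C _ r
    | add x y _ _ hx hy => exact hx.add hy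
    | mul x y _ _ hx hy => simpa using hx.mul hy
  · intro hf
    rw [f.as_sum]
    refine sum_mem fun σ hσ => ?_
    rw [show monomial σ (coeff σ f) = coeff σ f • monomial σ (1 : K) by simp [smul_monomial]]
    obtain ⟨hab, hac⟩ := (weight_segreWeight_eq_zero_iff m n p σ).mp (hf (mem_support_iff.mp hσ))
    have h : monomial σ (1 : K) ∈ segreRing K m n p :=
      Algebra.subset_adjoin ⟨σ, hab, hac, rfl⟩
    exact Subalgebra.smul_mem _ h _

/-- The Segre product `R` of three polynomial rings over a field is an integral domain
which is integrally closed in its field of fractions, i.e. a normal domain. -/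
theorem segreRing_isDomain_isIntegrallyClosed (K : Type*) [Field K] (m n p : ℕ)
    (hm : 2 ≤ m) (hn : 2 ≤ n) (hp : 2 ≤ p) :
    IsDomain (segreRing K m n p) ∧ IsIntegrallyClosed (segreRing K m n p) := by
  refine ⟨inferInstance, ?_⟩
  refine IsIntegrallyClosed.of_injective_of_forall_mul_mem_range
    (segreRing K m n p).val.toRingHom Subtype.val_injective ?_
  rintro s b hs ⟨r, hr⟩
  let _ := weightedGradedAlgebra K (segreWeight m n p)
  have hb : b ∈ segreRing K m n p := by
    rw [mem_segreRing_iff]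
    refine GradedRing.mem_zero_of_mul_mem_zero
      (weightedHomogeneousSubmodule K (segreWeight m n p)) (a := (s : MvPolynomial _ K))
      ((mem_segreRing_iff K m n p _).mp s.2) (by simpa using hs) ?_
    rw [← mem_segreRing_iff]
    have hrs : (r : MvPolynomial (Fin m ⊕ Fin n ⊕ Fin p) K) = (s : MvPolynomial _ K) * b := hr
    exact hrs ▸ r.2
  exact ⟨⟨b, hb⟩, rfl⟩
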